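/- Let (W,S) be a Coxeter system of finite rank, α a root, w ∈ W, and p ≥ 1 an integer. Then: (1) α is w-periodic if and only if α is w^p-periodic; (2) α is w-even (respectively w-odd) if and only if α is w^p-even (respectively w^p-odd). -/

import Mathlib

namespace CoxeterPaper

/-- The entry `-cos (π / m i j)` of the matrix of the standard bilinear form,
interpreted as `-1` when `m i j = ∞` (encoded as `0`). -/
noncomputable def formEntry {B : Type*} (M : CoxeterMatrix B) (i j : B) : ℝ :=
  if M i j = 0 then -1 else - Real.cos (Real.pi / (M i j : ℝ))

/-- The standard bilinear form associated to a Coxeter matrix, on `V = B → ℝ`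
(with basis `{α_s : s ∈ S}` identified with the standard basis). -/
noncomputable def bilin {B : Type*} [Fintype B] (M : CoxeterMatrix B) (v w : B → ℝ) : ℝ :=
  ∑ i, ∑ j, v i * w j * formEntry M i j

/-- The standard bilinear form is positive definite. -/
def IsPosDef {B : Type*} [Fintype B] (M : CoxeterMatrix B) : Prop :=
  ∀ v : B → ℝ, v ≠ 0 → 0 < bilin M v v

/-- The standard bilinear form is positive semidefinite. -/
def IsPosSemidef {B : Type*} [Fintype B] (M : CoxeterMatrix B) : Prop :=
  ∀ v : B → ℝ, 0 ≤ bilin M v v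

/-- The Coxeter graph: vertices are the elements of `B`, and `i ≠ j` are adjacent
iff `m i j ≥ 3` (including `m i j = ∞`, encoded as `0`), i.e. iff `m i j ≠ 2`. -/
def coxeterGraph {B : Type*} (M : CoxeterMatrix B) : SimpleGraph B :=
  SimpleGraph.fromRel fun i j => M i j ≠ 2

/-- A Coxeter matrix (system) is irreducible if its Coxeter graph is connected. -/
def IsIrreducible {B : Type*} (M : CoxeterMatrix B) : Prop := (coxeterGraph M).Connected

/-- The simple root `α_i`, as the `i`-th standard basis vector of `V = B → ℝ`. -/
noncomputable def simpleRoot {B : Type*} [DecidableEq B] (i : B) : B → ℝ := Pi.single i 1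

/-- The reflection `σ_i : λ ↦ λ - 2 (α_i, λ) α_i` of the canonical geometric
representation of a Coxeter system. -/
noncomputable def reflMap {B : Type*} [Fintype B] [DecidableEq B] (M : CoxeterMatrix B) (i : B) :
    Module.End ℝ (B → ℝ) :=
  LinearMap.id -
    (2 : ℝ) • (∑ j : B, formEntry M i j • (LinearMap.proj j : (B → ℝ) →ₗ[ℝ] ℝ)).smulRight
      (simpleRoot i)

/-- `ρ` is the canonical geometric representation `σ : W → GL(V)` of the Coxeter
system `cs`: the homomorphism sending each simple reflection `s_i` to `σ_i`
(such a homomorphism is unique, since the `s_i` generate `W`). -/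
def IsGeometricRep {B W : Type*} [Fintype B] [DecidableEq B] [Group W] {M : CoxeterMatrix B}
    (cs : CoxeterSystem M W) (ρ : W →* Module.End ℝ (B → ℝ)) : Prop :=
  ∀ i : B, ρ (cs.simple i) = reflMap M i

/-- `v` is a root: an element of `Φ = {w(α_i) : w ∈ W, i ∈ B}`. -/
def IsRoot {B W : Type*} [DecidableEq B] [Group W] (ρ : W →* Module.End ℝ (B → ℝ))
    (v : B → ℝ) : Prop :=
  ∃ (w : W) (i : B), v = ρ w (simpleRoot i)

/-- All coordinates of `v` in the basis of simple roots are `≥ 0`. -/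
def IsPositiveVec {B : Type*} (v : B → ℝ) : Prop := ∀ i, 0 ≤ v i

/-- All coordinates of `v` in the basis of simple roots are `≤ 0`. -/
def IsNegativeVec {B : Type*} (v : B → ℝ) : Prop := ∀ i, v i ≤ 0

/-- The root `α` separates `u` and `v`: `uα` and `vα` have opposite signs. -/
def Separates {B W : Type*} [Group W] (ρ : W →* Module.End ℝ (B → ℝ)) (u v : W)
    (α : B → ℝ) : Prop :=
  (IsPositiveVec (ρ u α) ∧ IsNegativeVec (ρ v α)) ∨
    (IsNegativeVec (ρ u α) ∧ IsPositiveVec (ρ v α))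

/-- The root `α` is `w`-periodic: `w^m α = α` for some positive integer `m`. -/
def IsPeriodic {B W : Type*} [Group W] (ρ : W →* Module.End ℝ (B → ℝ)) (w : W)
    (α : B → ℝ) : Prop :=
  ∃ m : ℕ, 0 < m ∧ ρ (w ^ m) α = α

/-- The set `{m ∈ ℤ : α separates w^m and w^(m+1)}`. -/
def sepSet {B W : Type*} [Group W] (ρ : W →* Module.End ℝ (B → ℝ)) (w : W)
    (α : B → ℝ) : Set ℤ :=
  {m : ℤ | Separates ρ (w ^ m) (w ^ (m + 1)) α}

/-- The root `α` is `w`-even: not `w`-periodic, and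
`{m ∈ ℤ : α separates w^m and w^(m+1)}` is finite of even cardinality. -/
def IsWEven {B W : Type*} [Group W] (ρ : W →* Module.End ℝ (B → ℝ)) (w : W)
    (α : B → ℝ) : Prop :=
  ¬ IsPeriodic ρ w α ∧ (sepSet ρ w α).Finite ∧ Even (sepSet ρ w α).ncard

/-- The root `α` is `w`-odd: not `w`-periodic, and
`{m ∈ ℤ : α separates w^m and w^(m+1)}` is finite of odd cardinality. -/
def IsWOdd {B W : Type*} [Group W] (ρ : W →* Module.End ℝ (B → ℝ)) (w : W)
    (α : B → ℝ) : Prop :=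
  ¬ IsPeriodic ρ w α ∧ (sepSet ρ w α).Finite ∧ Odd (sepSet ρ w α).ncard

section Reflections

variable {B : Type*} (M : CoxeterMatrix B)

theorem formEntry_self (i : B) : formEntry M i i = 1 := by
  simp [formEntry]

theorem formEntry_comm (i j : B) : formEntry M i j = formEntry M j i := by
  simp only [formEntry, M.symmetric i j]

variable [Fintype B]

theorem bilin_eq_sum (v w : B → ℝ) :
    bilin M v w = ∑ i, v i * ∑ j, formEntry M i j * w j := by
  simp only [bilin, Finset.mul_sum]
  exact Finset.sum_congr rfl fun i _ => Finset.sum_congr rfl fun j _ => by ring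

variable [DecidableEq B]

theorem reflMap_apply (i : B) (v : B → ℝ) :
    reflMap M i v = v - (2 * ∑ j, formEntry M i j * v j) • simpleRoot i := by
  simp [reflMap, smul_smul]

theorem reflMap_simpleRoot (i j : B) :
    reflMap M i (simpleRoot j) = simpleRoot j - (2 * formEntry M i j) • simpleRoot i := by
  rw [reflMap_apply]
  simp [simpleRoot, Pi.single_apply]

theorem reflMap_simpleRoot_self (i : B) : reflMap M i (simpleRoot i) = -simpleRoot i := by
  rw [reflMap_simpleRoot, formEntry_self]
  module

theorem bilin_simpleRoot_smul_self (i : B) (c : ℝ) :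
    bilin M (c • simpleRoot i) (c • simpleRoot i) = c ^ 2 := by
  simp [bilin_eq_sum, simpleRoot, Pi.single_apply, formEntry_self, sq]

theorem bilin_sub_smul_simpleRoot (i : B) (c : ℝ) (v : B → ℝ) :
    bilin M (v - c • simpleRoot i) (v - c • simpleRoot i) =
      bilin M v v - 2 * c * (∑ j, formEntry M i j * v j) + c ^ 2 := by
  have h : ∑ j, v j * formEntry M j i = ∑ j, formEntry M i j * v j :=
    Finset.sum_congr rfl fun j _ => by rw [formEntry_comm M i j, mul_comm]
  have h' : ∀ k, ∑ j, formEntry M k j * (v - c • simpleRoot i) j =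
      ∑ j, formEntry M k j * v j - c * formEntry M k i := fun k => by
    simp [simpleRoot, Pi.single_apply, mul_sub, Finset.sum_sub_distrib, mul_comm]
  simp only [bilin_eq_sum, h']
  simp only [simpleRoot, Pi.sub_apply, Pi.smul_apply, Pi.single_apply, smul_eq_mul, sub_mul, mul_sub,
    Finset.sum_sub_distrib, mul_ite, ite_mul, mul_one, mul_zero, zero_mul, Finset.sum_ite_eq',
    Finset.mem_univ, if_true, formEntry_self, mul_left_comm _ c, ← Finset.mul_sum, h]
  ring

theorem bilin_reflMap_self (i : B) (v : B → ℝ) :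
    bilin M (reflMap M i v) (reflMap M i v) = bilin M v v := by
  rw [reflMap_apply, bilin_sub_smul_simpleRoot]
  ring

end Reflections

section Dihedral

/-- The Chebyshev-type sequence `0, 1, 2 * c, 4 * c ^ 2 - 1, …` giving the coordinates of the roots of a
dihedral group. -/
noncomputable def dihedralCoeff (c : ℝ) : ℕ → ℝ
  | 0 => 0
  | 1 => 1
  | k + 2 => 2 * c * dihedralCoeff c (k + 1) - dihedralCoeff c k

theorem dihedralCoeff_one (k : ℕ) : dihedralCoeff 1 k = k := by
  induction k using Nat.twoStepInduction with
  | zero => simp [dihedralCoeff]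
  | one => simp [dihedralCoeff]
  | more k h₀ h₁ =>
    rw [dihedralCoeff, h₀, h₁]
    push_cast
    ring

theorem sin_mul_dihedralCoeff_cos (θ : ℝ) (k : ℕ) :
    Real.sin θ * dihedralCoeff (Real.cos θ) k = Real.sin (k * θ) := by
  induction k using Nat.twoStepInduction with
  | zero => simp [dihedralCoeff]
  | one => simp [dihedralCoeff]
  | more k h₀ h₁ =>
    rw [dihedralCoeff, mul_sub, mul_left_comm, h₀, h₁]
    have h₂ : ((k + 2 : ℕ) : ℝ) * θ = ((k + 1 : ℕ) : ℝ) * θ + θ := by push_cast; ring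
    have h₃ : (k : ℝ) * θ = ((k + 1 : ℕ) : ℝ) * θ - θ := by push_cast; ring
    rw [h₂, h₃, Real.sin_add, Real.sin_sub]
    ring

variable {B : Type*} (M : CoxeterMatrix B)

theorem dihedralCoeff_nonneg {i j : B} (hij : i ≠ j) {k : ℕ} (hk : M i j ≠ 0 → k ≤ M i j) :
    0 ≤ dihedralCoeff (-formEntry M i j) k := by
  by_cases h₀ : M i j = 0
  · simp [formEntry, h₀, dihedralCoeff_one]
  · have hm : (2 : ℝ) ≤ M i j := by
      have := M.off_diagonal i j hij
      exact_mod_cast (by omega : 2 ≤ M i j)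
    have hkm : (k : ℝ) ≤ M i j := by exact_mod_cast hk h₀
    have hsin : 0 < Real.sin (Real.pi / M i j) :=
      Real.sin_pos_of_pos_of_lt_pi (by positivity) (div_lt_self Real.pi_pos (by linarith))
    have hform : -formEntry M i j = Real.cos (Real.pi / M i j) := by simp [formEntry, h₀]
    refine nonneg_of_mul_nonneg_right (a := Real.sin (Real.pi / M i j)) ?_ hsin
    rw [hform, sin_mul_dihedralCoeff_cos]
    refine Real.sin_nonneg_of_nonneg_of_le_pi (by positivity) ?_
    rw [mul_div_assoc', div_le_iff₀ (by linarith), mul_comm]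
    exact mul_le_mul_of_nonneg_left hkm Real.pi_pos.le

end Dihedral

section AlternatingWords

variable {B W : Type*} [Group W] {M : CoxeterMatrix B}

/-- A nontrivial dihedral right factor of `w` ending in the right descent `t`, chosen as long as
possible. -/
theorem exists_alternating_factor (cs : CoxeterSystem M W) {w : W} {t : B}
    (ht : cs.length (w * cs.simple t) < cs.length w) (s : B) :
    ∃ (v : W) (k : ℕ), 0 < k ∧ w = v * cs.wordProd (CoxeterSystem.alternatingWord s t k) ∧
      cs.length w = cs.length v + k ∧
      cs.length v < cs.length (v * cs.simple s) ∧ cs.length v < cs.length (v * cs.simple t) := by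
  classical
  let P : ℕ → Prop := fun k => ∃ v : W,
    w = v * cs.wordProd (CoxeterSystem.alternatingWord s t k) ∧ cs.length w = cs.length v + k
  have hP₁ : P 1 := by
    refine ⟨w * cs.simple t, by simp [CoxeterSystem.alternatingWord], ?_⟩
    have := cs.length_mul_simple w t
    omega
  have hbound : ∀ k, P k → k ≤ cs.length w := fun k ⟨_, _, h⟩ => by omega
  have hpos : 1 ≤ cs.length w := hbound 1 hP₁
  obtain ⟨v, hv, hlen⟩ : P (Nat.findGreatest P (cs.length w)) := Nat.findGreatest_spec hpos hP₁
  have hk : 1 ≤ Nat.findGreatest P (cs.length w) := Nat.le_findGreatest hpos hP₁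
  have hmax : ¬ P (Nat.findGreatest P (cs.length w) + 1) := fun h =>
    absurd (Nat.le_findGreatest (hbound _ h) h) (by omega)
  generalize Nat.findGreatest P (cs.length w) = k at hv hlen hk hmax
  have hnext : cs.length v < cs.length (v * cs.simple (if Even k then t else s)) := by
    by_contra hlt
    refine hmax ⟨v * cs.simple (if Even k then t else s), ?_, ?_⟩
    · rw [CoxeterSystem.alternatingWord_succ', cs.wordProd_cons, hv]
      simp [mul_assoc]
    · have := cs.length_mul_simple v (if Even k then t else s)
      omega
  have hfirst : cs.length v < cs.length (v * cs.simple (if Even k then s else t)) := by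
    by_contra hlt
    obtain ⟨k, rfl⟩ : ∃ l, k = l + 1 := ⟨k - 1, by omega⟩
    have hw : w = v * cs.simple (if Even (k + 1) then s else t) *
        cs.wordProd (CoxeterSystem.alternatingWord s t k) := by
      rw [hv, CoxeterSystem.alternatingWord_succ', cs.wordProd_cons]
      by_cases hk : Even k <;> simp [Nat.even_add_one, hk, mul_assoc]
    have h₁ := cs.length_mul_le (v * cs.simple (if Even (k + 1) then s else t))
      (cs.wordProd (CoxeterSystem.alternatingWord s t k))
    have h₂ := cs.length_wordProd_le (CoxeterSystem.alternatingWord s t k)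
    rw [CoxeterSystem.length_alternatingWord] at h₂
    rw [← hw] at h₁
    have := cs.length_mul_simple v (if Even (k + 1) then s else t)
    omega
  refine ⟨v, k, hk, hv, hlen, ?_⟩
  by_cases hk' : Even k
  · simp only [hk', if_true] at hnext hfirst
    exact ⟨hfirst, hnext⟩
  · simp only [hk', if_false] at hnext hfirst
    exact ⟨hnext, hfirst⟩

theorem lt_of_length_eq_add_alternating (cs : CoxeterSystem M W) {w v : W} {s t : B} {k : ℕ}
    (hw : w = v * cs.wordProd (CoxeterSystem.alternatingWord s t k))
    (hlen : cs.length w = cs.length v + k)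
    (hs : cs.length w < cs.length (w * cs.simple s)) (hM : M s t ≠ 0) : k < M s t := by
  have h₁ := cs.length_mul_le v (cs.wordProd (CoxeterSystem.alternatingWord s t k))
  have h₂ := cs.length_wordProd_le (CoxeterSystem.alternatingWord s t k)
  rw [← hw] at h₁
  by_contra hlt
  rcases (not_lt.1 hlt).lt_or_eq with hgt | heq
  · refine cs.not_isReduced_alternatingWord s t hM hgt ?_
    rw [CoxeterSystem.length_alternatingWord] at h₂
    rw [CoxeterSystem.IsReduced, CoxeterSystem.length_alternatingWord]
    omega
  · have hk : M s t * 2 - k = (k - 1) + 1 := by omega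
    rw [cs.prod_alternatingWord_eq_prod_alternatingWord_sub s t k (by omega), hk,
      CoxeterSystem.alternatingWord_succ, cs.wordProd_concat, ← mul_assoc] at hw
    have h₃ := cs.length_mul_le v (cs.wordProd (CoxeterSystem.alternatingWord s t (k - 1)))
    have h₄ := cs.length_wordProd_le (CoxeterSystem.alternatingWord s t (k - 1))
    rw [CoxeterSystem.length_alternatingWord] at h₄
    have h₅ : w * cs.simple s = v * cs.wordProd (CoxeterSystem.alternatingWord s t (k - 1)) := by
      rw [hw, cs.simple_mul_simple_cancel_right]
    rw [h₅] at hs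
    omega

end AlternatingWords

section Orbits

variable {B W : Type*} [Group W] {ρ : W →* Module.End ℝ (B → ℝ)}

theorem isPositiveVec_simpleRoot [DecidableEq B] (i : B) : IsPositiveVec (simpleRoot i) := by
  intro j
  by_cases h : j = i <;> simp [simpleRoot, h]

theorem IsPositiveVec.smul_add_smul {v w : B → ℝ} (hv : IsPositiveVec v) (hw : IsPositiveVec w)
    {a b : ℝ} (ha : 0 ≤ a) (hb : 0 ≤ b) : IsPositiveVec (a • v + b • w) := fun i =>
  add_nonneg (mul_nonneg ha (hv i)) (mul_nonneg hb (hw i))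

theorem IsRoot.apply [DecidableEq B] {β : B → ℝ} (hβ : IsRoot ρ β) (w : W) : IsRoot ρ (ρ w β) := by
  obtain ⟨u, i, rfl⟩ := hβ
  exact ⟨w * u, i, by rw [map_mul, Module.End.mul_apply]⟩

theorem apply_injective (ρ : W →* Module.End ℝ (B → ℝ)) (w : W) :
    Function.Injective (ρ w) :=
  Function.LeftInverse.injective (g := ρ w⁻¹) fun v => by
    rw [← Module.End.mul_apply, ← map_mul, inv_mul_cancel, map_one, Module.End.one_apply]

theorem injective_zpow_apply {w : W} {α : B → ℝ} (h : ¬ IsPeriodic ρ w α) :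
    Function.Injective fun m : ℤ => ρ (w ^ m) α := by
  suffices ∀ a b : ℤ, ρ (w ^ a) α = ρ (w ^ b) α → ¬ a < b from
    fun a b hab => le_antisymm (not_lt.1 (this b a hab.symm)) (not_lt.1 (this a b hab))
  intro a b hab hlt
  refine h ⟨(b - a).toNat, by omega, apply_injective ρ (w ^ a) ?_⟩
  rw [← Module.End.mul_apply, ← map_mul, ← zpow_natCast, ← zpow_add,
    show a + ((b - a).toNat : ℤ) = b by omega, hab]

theorem apply_pow_eq_self {u : W} {α : B → ℝ} (h : ρ u α = α) (p : ℕ) :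
    ρ (u ^ p) α = α := by
  induction p with
  | zero => simp
  | succ p ih => rw [pow_succ, map_mul, Module.End.mul_apply, h, ih]

theorem isPeriodic_pow_iff (ρ : W →* Module.End ℝ (B → ℝ)) (w : W) (α : B → ℝ) {p : ℕ}
    (hp : 1 ≤ p) : IsPeriodic ρ w α ↔ IsPeriodic ρ (w ^ p) α := by
  constructor
  · rintro ⟨m, hm, h⟩
    exact ⟨m, hm, by rw [← pow_mul, mul_comm, pow_mul]; exact apply_pow_eq_self h p⟩
  · rintro ⟨m, hm, h⟩
    exact ⟨p * m, Nat.mul_pos hp hm, by rwa [pow_mul]⟩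

end Orbits

section RootSigns

variable {B W : Type*} [Fintype B] [DecidableEq B] [Group W] {M : CoxeterMatrix B}
  {cs : CoxeterSystem M W} {ρ : W →* Module.End ℝ (B → ℝ)}

theorem IsGeometricRep.alternatingWord_apply_simpleRoot (hρ : IsGeometricRep cs ρ) (s t : B)
    (k : ℕ) :
    ρ (cs.wordProd (CoxeterSystem.alternatingWord s t k)) (simpleRoot s) =
      if Even k then
        dihedralCoeff (-formEntry M s t) (k + 1) • simpleRoot s +
          dihedralCoeff (-formEntry M s t) k • simpleRoot t
      else
        dihedralCoeff (-formEntry M s t) k • simpleRoot s +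
          dihedralCoeff (-formEntry M s t) (k + 1) • simpleRoot t := by
  induction k with
  | zero => simp [CoxeterSystem.alternatingWord, dihedralCoeff]
  | succ k ih =>
    rw [CoxeterSystem.alternatingWord_succ', cs.wordProd_cons, map_mul, Module.End.mul_apply, ih,
      hρ]
    by_cases hk : Even k
    · simp only [hk, if_true, Nat.even_add_one, not_true, if_false, map_add, map_smul,
        reflMap_simpleRoot, formEntry_self, dihedralCoeff, formEntry_comm M t s]
      module
    · simp only [hk, if_true, Nat.even_add_one, not_false_eq_true, if_false, map_add, map_smul,
        reflMap_simpleRoot, formEntry_self, dihedralCoeff]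
      module

theorem IsGeometricRep.isPositiveVec_of_length_lt (hρ : IsGeometricRep cs ρ) {w : W} {s : B}
    (hs : cs.length w < cs.length (w * cs.simple s)) : IsPositiveVec (ρ w (simpleRoot s)) := by
  induction hn : cs.length w using Nat.strong_induction_on generalizing w s with
  | _ n ih =>
    subst hn
    rcases eq_or_ne w 1 with rfl | hw
    · simpa using isPositiveVec_simpleRoot s
    · obtain ⟨t, ht⟩ := cs.exists_rightDescent_of_ne_one hw
      have hst : s ≠ t := by
        rintro rfl
        exact lt_asymm hs ht
      obtain ⟨v, k, hk, hwv, hlen, hvs, hvt⟩ := exists_alternating_factor cs ht s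
      have hM := lt_of_length_eq_add_alternating cs hwv hlen hs
      have hs' := ih _ (by omega) hvs rfl
      have ht' := ih _ (by omega) hvt rfl
      have h₀ := dihedralCoeff_nonneg M hst (k := k) fun h => (hM h).le
      have h₁ := dihedralCoeff_nonneg M hst (k := k + 1) hM
      rw [hwv, map_mul, Module.End.mul_apply, hρ.alternatingWord_apply_simpleRoot]
      split_ifs <;> rw [map_add, map_smul, map_smul]
      · exact hs'.smul_add_smul ht' h₁ h₀
      · exact hs'.smul_add_smul ht' h₀ h₁

theorem IsGeometricRep.isPositiveVec_or_isNegativeVec (hρ : IsGeometricRep cs ρ) {β : B → ℝ}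
    (hβ : IsRoot ρ β) : IsPositiveVec β ∨ IsNegativeVec β := by
  obtain ⟨w, i, rfl⟩ := hβ
  rcases cs.length_mul_simple w i with h | h
  · exact .inl (hρ.isPositiveVec_of_length_lt (by omega))
  · have hpos : IsPositiveVec (ρ (w * cs.simple i) (simpleRoot i)) :=
      hρ.isPositiveVec_of_length_lt (by rw [cs.simple_mul_simple_cancel_right]; omega)
    rw [map_mul, Module.End.mul_apply, hρ, reflMap_simpleRoot_self, map_neg] at hpos
    exact .inr fun j => neg_nonneg.1 (hpos j)

theorem IsGeometricRep.bilin_self (hρ : IsGeometricRep cs ρ) {β : B → ℝ} (hβ : IsRoot ρ β) :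
    bilin M β β = 1 := by
  obtain ⟨w, i, rfl⟩ := hβ
  induction w using cs.simple_induction_left with
  | one => simpa using bilin_simpleRoot_smul_self M i 1
  | mul_simple_left w j ih => rwa [map_mul, Module.End.mul_apply, hρ, bilin_reflMap_self]

theorem IsGeometricRep.isNegativeVec_iff (hρ : IsGeometricRep cs ρ) {β : B → ℝ}
    (hβ : IsRoot ρ β) : IsNegativeVec β ↔ ¬ IsPositiveVec β := by
  refine ⟨fun hn hp => ?_, (hρ.isPositiveVec_or_isNegativeVec hβ).resolve_left⟩
  have h₀ : β = 0 := funext fun i => le_antisymm (hn i) (hp i)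
  have h₁ := hρ.bilin_self hβ
  simp [h₀, bilin] at h₁

theorem IsGeometricRep.separates_iff (hρ : IsGeometricRep cs ρ) {α : B → ℝ} (hα : IsRoot ρ α)
    (u v : W) :
    Separates ρ u v α ↔ ¬ (IsPositiveVec (ρ u α) ↔ IsPositiveVec (ρ v α)) := by
  rw [Separates, hρ.isNegativeVec_iff (hα.apply u), hρ.isNegativeVec_iff (hα.apply v)]
  tauto

/-- A simple reflection changes the sign of no root except plus or minus its own simple root. -/
theorem IsGeometricRep.eq_or_eq_neg_simpleRoot (hρ : IsGeometricRep cs ρ) {β : B → ℝ}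
    (hβ : IsRoot ρ β) {i : B}
    (h : ¬ (IsPositiveVec β ↔ IsPositiveVec (ρ (cs.simple i) β))) :
    β = simpleRoot i ∨ β = -simpleRoot i := by
  have hcoord : ∀ j, j ≠ i → ρ (cs.simple i) β j = β j := fun j hj => by
    simp [hρ i, reflMap_apply, simpleRoot, hj]
  have hsep : Separates ρ 1 (cs.simple i) β := by
    rw [hρ.separates_iff hβ]
    simpa using h
  have hzero : ∀ j, j ≠ i → β j = 0 := fun j hj => by
    have h' := hcoord j hj
    simp only [Separates, map_one, Module.End.one_apply] at hsep
    rcases hsep with ⟨h₁, h₂⟩ | ⟨h₁, h₂⟩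
    · exact le_antisymm (h' ▸ h₂ j) (h₁ j)
    · exact le_antisymm (h₁ j) (h' ▸ h₂ j)
  have hβi : β = β i • simpleRoot i := by
    funext j
    by_cases hj : j = i
    · subst hj
      simp [simpleRoot]
    · simp [simpleRoot, hj, hzero j hj]
  have hsq : β i ^ 2 = 1 := by
    rw [← bilin_simpleRoot_smul_self M i (β i), ← hβi, hρ.bilin_self hβ]
  rcases mul_self_eq_one_iff.1 ((sq _).symm.trans hsq) with h₁ | h₁
  · exact .inl (by rw [hβi, h₁, one_smul])
  · exact .inr (by rw [hβi, h₁, neg_one_smul])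

/-- Every element of `W` changes the sign of only finitely many roots. -/
theorem IsGeometricRep.finite_sign_changes (hρ : IsGeometricRep cs ρ) (w : W) :
    {β | IsRoot ρ β ∧ ¬ (IsPositiveVec β ↔ IsPositiveVec (ρ w β))}.Finite := by
  induction w using cs.simple_induction_left with
  | one => simp
  | mul_simple_left w i ih =>
    have hfin : ((ρ w) ⁻¹' {simpleRoot i, -simpleRoot i}).Finite :=
      Set.Finite.preimage (apply_injective ρ w).injOn (by simp)
    refine (ih.union hfin).subset ?_
    rintro β ⟨hβ, h⟩
    rw [map_mul, Module.End.mul_apply] at h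
    by_cases h' : IsPositiveVec β ↔ IsPositiveVec (ρ w β)
    · rw [h'] at h
      exact .inr (hρ.eq_or_eq_neg_simpleRoot (hβ.apply w) h)
    · exact .inl ⟨hβ, h'⟩

theorem IsGeometricRep.sepSet_eq (hρ : IsGeometricRep cs ρ) {α : B → ℝ} (hα : IsRoot ρ α)
    (w : W) :
    sepSet ρ w α =
      {m : ℤ | ¬ (IsPositiveVec (ρ (w ^ m) α) ↔ IsPositiveVec (ρ (w ^ (m + 1)) α))} :=
  Set.ext fun _ => hρ.separates_iff hα _ _

theorem IsGeometricRep.finite_sepSet (hρ : IsGeometricRep cs ρ) {α : B → ℝ} (hα : IsRoot ρ α)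
    {w : W} (h : ¬ IsPeriodic ρ w α) : (sepSet ρ w α).Finite := by
  rw [hρ.sepSet_eq hα]
  refine ((hρ.finite_sign_changes w).preimage (injective_zpow_apply h).injOn).subset ?_
  intro m hm
  refine ⟨hα.apply _, ?_⟩
  rwa [← Module.End.mul_apply, ← map_mul, ← zpow_one_add, add_comm 1 m]

end RootSigns

section SignChanges

theorem odd_card_sign_changes_Ico (f : ℤ → Prop) [DecidablePred fun m => ¬ (f m ↔ f (m + 1))]
    (a : ℤ) (n : ℕ) :
    Odd ((Finset.Ico a (a + n)).filter fun m => ¬ (f m ↔ f (m + 1))).card ↔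
      ¬ (f a ↔ f (a + n)) := by
  induction n with
  | zero => simp
  | succ n ih =>
    have hIco : Finset.Ico a (a + (n + 1 : ℕ)) = insert (a + n : ℤ) (Finset.Ico a (a + n)) := by
      ext m
      simp only [Finset.mem_Ico, Finset.mem_insert]
      omega
    have hcast : a + ((n + 1 : ℕ) : ℤ) = a + n + 1 := by push_cast; ring
    rw [hIco, Finset.filter_insert, hcast]
    split_ifs with h
    · rw [ih]
      tauto
    · rw [Finset.card_insert_of_notMem (by simp), Nat.odd_add_one, ih]
      tauto

/-- The parity of the number of sign changes of a sequence is determined by its values far out. -/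
theorem exists_odd_ncard_sign_changes_iff (f : ℤ → Prop)
    (hf : {m : ℤ | ¬ (f m ↔ f (m + 1))}.Finite) :
    ∃ N₀ : ℕ, ∀ N : ℕ, N₀ ≤ N →
      (Odd {m : ℤ | ¬ (f m ↔ f (m + 1))}.ncard ↔ ¬ (f (-N) ↔ f N)) := by
  classical
  obtain ⟨b, hb⟩ := hf.bddAbove
  obtain ⟨a, ha⟩ := hf.bddBelow
  refine ⟨(b + 1).toNat + (-a).toNat, fun N hN => ?_⟩
  have hset : {m : ℤ | ¬ (f m ↔ f (m + 1))} =
      ((Finset.Ico (-N : ℤ) (-N + (2 * N : ℕ))).filter fun m => ¬ (f m ↔ f (m + 1)) :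
        Finset ℤ) := by
    ext m
    simp only [Finset.coe_filter, Finset.mem_Ico, Set.mem_ofPred_eq]
    refine ⟨fun h => ⟨?_, h⟩, fun h => h.2⟩
    have h₁ := hb h
    have h₂ := ha h
    omega
  rw [hset, Set.ncard_coe_finset, odd_card_sign_changes_Ico,
    show (-N + (2 * N : ℕ) : ℤ) = N by push_cast; ring]

end SignChanges

theorem IsGeometricRep.odd_ncard_sepSet_pow_iff {B W : Type*} [Fintype B] [DecidableEq B]
    [Group W] {M : CoxeterMatrix B} {cs : CoxeterSystem M W} {ρ : W →* Module.End ℝ (B → ℝ)}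
    (hρ : IsGeometricRep cs ρ) {w : W} {α : B → ℝ} (hα : IsRoot ρ α) {p : ℕ} (hp : 1 ≤ p)
    (h : ¬ IsPeriodic ρ w α) :
    Odd (sepSet ρ w α).ncard ↔ Odd (sepSet ρ (w ^ p) α).ncard := by
  have h₁ := hρ.finite_sepSet hα h
  have h₂ := hρ.finite_sepSet hα (mt (isPeriodic_pow_iff ρ w α hp).2 h)
  rw [hρ.sepSet_eq hα] at h₁ h₂
  obtain ⟨N₁, hN₁⟩ := exists_odd_ncard_sign_changes_iff (fun m => IsPositiveVec (ρ (w ^ m) α)) h₁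
  obtain ⟨N₂, hN₂⟩ :=
    exists_odd_ncard_sign_changes_iff (fun m => IsPositiveVec (ρ ((w ^ p) ^ m) α)) h₂
  have hle : N₁ ≤ p * (N₁ + N₂) := (Nat.le_add_right _ _).trans (Nat.le_mul_of_pos_left _ hp)
  rw [hρ.sepSet_eq hα, hρ.sepSet_eq hα, hN₁ _ hle, hN₂ _ (Nat.le_add_left N₂ N₁)]
  simp only [← zpow_natCast w p, ← zpow_mul, Nat.cast_mul, mul_neg]

/-- For a root `α`, `w ∈ W` and an integer `p ≥ 1`: `α` is
`w`-periodic iff `α` is `w^p`-periodic; `α` is `w`-even (resp. `w`-odd) iff `α` is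
`w^p`-even (resp. `w^p`-odd). -/
theorem periodic_even_odd_power
    {B W : Type*} [Fintype B] [DecidableEq B] [Group W] {M : CoxeterMatrix B}
    (cs : CoxeterSystem M W) (ρ : W →* Module.End ℝ (B → ℝ)) (hρ : IsGeometricRep cs ρ)
    (w : W) (α : B → ℝ) (hα : IsRoot ρ α) (p : ℕ) (hp : 1 ≤ p) :
    (IsPeriodic ρ w α ↔ IsPeriodic ρ (w ^ p) α) ∧
    (IsWEven ρ w α ↔ IsWEven ρ (w ^ p) α) ∧
    (IsWOdd ρ w α ↔ IsWOdd ρ (w ^ p) α) := by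
  have hper := isPeriodic_pow_iff ρ w α hp
  refine ⟨hper, ?_, ?_⟩
  all_goals
    by_cases h : IsPeriodic ρ w α
    · simp only [IsWEven, IsWOdd, h, hper.1 h, not_true, false_and]
    · have h' := mt hper.2 h
      have hodd := hρ.odd_ncard_sepSet_pow_iff hα hp h
      simp only [IsWEven, IsWOdd, h, h', hρ.finite_sepSet hα h, hρ.finite_sepSet hα h',
        not_false_eq_true, true_and, ← Nat.not_odd_iff_even, hodd]

end CoxeterPaper
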